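/- Let X be a non-reflexive complex Banach space which is a quotient of a von Neumann algebra (i.e., X is isomorphic as a Banach space to A/Z for some von Neumann algebra A and closed subspace Z of A). Then no bounded linear operator on X is topologically transitive. -/

import Mathlib

set_option synthInstance.maxHeartbeats 1000000
set_option maxHeartbeats 1000000

open NormedSpace

/-- A bounded linear operator `T` on a complex Banach space `X` is topologically transitive
if for every pair `U, V` of nonempty open subsets of `X` there is a positive integer `n`
with `T^n(U) ∩ V ≠ ∅`. -/
def TopologicallyTransitive {X : Type*} [NormedAddCommGroup X] [NormedSpace ℂ X]
    (T : X →L[ℂ] X) : Prop :=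
  ∀ U V : Set X, IsOpen U → IsOpen V → U.Nonempty → V.Nonempty →
    ∃ n : ℕ, 0 < n ∧ ((T ^ n) '' U ∩ V).Nonempty



section CStar
variable {A : Type*} [CStarAlgebra A] [PartialOrder A]

/-- The least nonnegative multiple of the unit dominating a self-adjoint element. -/
noncomputable def upperBoundValue (h : selfAdjoint A) : ℝ :=
  sInf {t : ℝ | 0 ≤ t ∧ (h : A) ≤ algebraMap ℝ A t}

theorem bddBelow_upperBoundValue (h : selfAdjoint A) :
    BddBelow {t : ℝ | 0 ≤ t ∧ (h : A) ≤ algebraMap ℝ A t} :=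
  ⟨0, fun _ ht => ht.1⟩

theorem upperBoundValue_le {h : selfAdjoint A} {t : ℝ} (ht : 0 ≤ t)
    (hh : (h : A) ≤ algebraMap ℝ A t) : upperBoundValue h ≤ t :=
  csInf_le (bddBelow_upperBoundValue h) ⟨ht, hh⟩

variable [StarOrderedRing A]

theorem nonempty_upperBoundValue (h : selfAdjoint A) :
    {t : ℝ | 0 ≤ t ∧ (h : A) ≤ algebraMap ℝ A t}.Nonempty :=
  ⟨‖(h : A)‖, norm_nonneg _, IsSelfAdjoint.le_algebraMap_norm_self h.2⟩

theorem upperBoundValue_smul_le {c : ℝ} (hc : 0 < c) (h : selfAdjoint A) :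
    upperBoundValue (c • h) ≤ c * upperBoundValue h := by
  rw [← div_le_iff₀' hc]
  refine le_csInf (nonempty_upperBoundValue h) ?_
  rintro t ⟨ht, hht⟩
  rw [div_le_iff₀' hc]
  refine upperBoundValue_le (by positivity) ?_
  have := smul_le_smul_of_nonneg_left hht hc.le
  rw [map_mul, ← Algebra.smul_def]
  simpa using this

theorem upperBoundValue_smul {c : ℝ} (hc : 0 < c) (h : selfAdjoint A) :
    upperBoundValue (c • h) = c * upperBoundValue h := by
  refine le_antisymm (upperBoundValue_smul_le hc h) ?_
  have := upperBoundValue_smul_le (inv_pos.2 hc) (c • h)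
  rw [smul_smul, inv_mul_cancel₀ hc.ne', one_smul, ← div_eq_inv_mul, le_div_iff₀' hc] at this
  exact this

theorem upperBoundValue_add (h k : selfAdjoint A) :
    upperBoundValue (h + k) ≤ upperBoundValue h + upperBoundValue k := by
  rw [← sub_le_iff_le_add]
  refine le_csInf (nonempty_upperBoundValue h) ?_
  rintro t ⟨ht, hht⟩
  rw [sub_le_comm]
  refine le_csInf (nonempty_upperBoundValue k) ?_
  rintro s ⟨hs, hks⟩
  rw [sub_le_iff_le_add, add_comm s t]
  refine upperBoundValue_le (by positivity) ?_
  rw [map_add]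
  exact add_le_add hht hks

theorem norm_le_upperBoundValue (h : selfAdjoint A) :
    ‖(h : A)‖ ≤ 2 * (upperBoundValue h + upperBoundValue (-h)) := by
  rw [← div_le_iff₀' two_pos, ← sub_le_iff_le_add]
  refine le_csInf (nonempty_upperBoundValue h) ?_
  rintro t ⟨ht, hht⟩
  rw [sub_le_comm]
  refine le_csInf (nonempty_upperBoundValue (-h)) ?_
  rintro s ⟨hs, hks⟩
  have h1 : ‖(h : A) + algebraMap ℝ A s‖ ≤ t + s := by
    have h0 : 0 ≤ (h : A) + algebraMap ℝ A s := by
      have : -(h : A) ≤ algebraMap ℝ A s := by simpa using hks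
      simpa [add_comm] using neg_le_iff_add_nonneg.1 this
    rw [CStarAlgebra.norm_le_iff_le_algebraMap _ (by positivity) h0, map_add]
    exact add_le_add_left hht _
  have h2 : ‖algebraMap ℝ A s‖ ≤ s := by
    have h0 : 0 ≤ algebraMap ℝ A s := algebraMap_nonneg A hs
    rw [CStarAlgebra.norm_le_iff_le_algebraMap _ hs h0]
  have h3 : ‖(h : A)‖ ≤ ‖(h : A) + algebraMap ℝ A s‖ + ‖algebraMap ℝ A s‖ := by
    simpa using norm_sub_le ((h : A) + algebraMap ℝ A s) (algebraMap ℝ A s)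
  linarith

/-- Jordan decomposition of a bounded real functional on the self-adjoint part. -/
theorem exists_nonneg_sub_eq (u : selfAdjoint A →ₗ[ℝ] ℝ) {M : ℝ} (hM : 0 ≤ M)
    (hu : ∀ h, u h ≤ M * ‖(h : A)‖) :
    ∃ φ ψ : selfAdjoint A →ₗ[ℝ] ℝ, (∀ h : selfAdjoint A, 0 ≤ (h : A) → 0 ≤ φ h) ∧
      (∀ h : selfAdjoint A, 0 ≤ (h : A) → 0 ≤ ψ h) ∧ u = φ - ψ ∧ φ 1 ≤ 2 * M ∧ ψ 1 ≤ 2 * M := by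
  let S : Submodule ℝ (selfAdjoint A × selfAdjoint A) :=
    LinearMap.ker (LinearMap.fst ℝ (selfAdjoint A) (selfAdjoint A) + LinearMap.snd ℝ _ _)
  obtain ⟨g, hg1, hg2⟩ := exists_extension_of_le_sublinear
    ⟨S, (u ∘ₗ LinearMap.fst ℝ _ _).domRestrict S⟩
    (fun x => 2 * M * (upperBoundValue x.1 + upperBoundValue x.2))
    (by
      intro c hc x
      simp only [Prod.smul_fst, Prod.smul_snd, upperBoundValue_smul hc]
      ring)
    (by
      intro x y
      have h1 := upperBoundValue_add x.1 y.1
      have h2 := upperBoundValue_add x.2 y.2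
      simp only [Prod.fst_add, Prod.snd_add]
      rw [← mul_add]
      exact mul_le_mul_of_nonneg_left (by linarith) (by positivity))
    (by
      rintro ⟨⟨h, k⟩, hx⟩
      have hk : k = -h := by
        have : h + k = 0 := hx
        exact (neg_eq_of_add_eq_zero_right this).symm
      subst hk
      have h1 := hu h
      have h2 := mul_le_mul_of_nonneg_left (norm_le_upperBoundValue h) hM
      change u h ≤ 2 * M * (upperBoundValue h + upperBoundValue (-h))
      linarith)
  have z0 : upperBoundValue (0 : selfAdjoint A) ≤ 0 := upperBoundValue_le le_rfl (by simp)
  have hneg : ∀ h : selfAdjoint A, 0 ≤ (h : A) → upperBoundValue (-h) ≤ 0 := fun h hh =>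
    upperBoundValue_le le_rfl (by simpa using hh)
  have hone : upperBoundValue (1 : selfAdjoint A) ≤ 1 := upperBoundValue_le zero_le_one (by simp)
  refine ⟨g ∘ₗ LinearMap.inl ℝ _ _, g ∘ₗ LinearMap.inr ℝ _ _, ?_, ?_, ?_, ?_, ?_⟩
  · intro h hh
    have h1 := hg2 (-h, 0)
    have h2 : g (-h, 0) = - g (h, 0) := by rw [← map_neg]; simp
    have h3 : 2 * M * (upperBoundValue (-h) + upperBoundValue (0 : selfAdjoint A)) ≤ 0 :=
      mul_nonpos_of_nonneg_of_nonpos (by positivity) (by linarith [hneg h hh])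
    simp only [LinearMap.comp_apply, LinearMap.inl_apply]
    linarith
  · intro h hh
    have h1 := hg2 (0, -h)
    have h2 : g (0, -h) = - g (0, h) := by rw [← map_neg]; simp
    have h3 : 2 * M * (upperBoundValue (0 : selfAdjoint A) + upperBoundValue (-h)) ≤ 0 :=
      mul_nonpos_of_nonneg_of_nonpos (by positivity) (by linarith [hneg h hh])
    simp only [LinearMap.comp_apply, LinearMap.inr_apply]
    linarith
  · ext h
    have h1 := hg1 ⟨(h, -h), by simp [S]⟩
    change g (h, -h) = u h at h1
    simp only [LinearMap.sub_apply, LinearMap.comp_apply, LinearMap.inl_apply,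
      LinearMap.inr_apply, ← map_sub]
    rw [← h1]
    simp
  · have h1 := hg2 (1, 0)
    have := mul_le_mul_of_nonneg_left (add_le_add hone z0) (by positivity : 0 ≤ 2 * M)
    simp only [LinearMap.comp_apply, LinearMap.inl_apply]
    simp only at h1
    linarith
  · have h1 := hg2 (0, 1)
    have := mul_le_mul_of_nonneg_left (add_le_add z0 hone) (by positivity : 0 ≤ 2 * M)
    simp only [LinearMap.comp_apply, LinearMap.inr_apply]
    simp only at h1
    linarith

theorem exists_dominating_real (u : selfAdjoint A →ₗ[ℝ] ℝ) {M : ℝ} (hM : 0 ≤ M)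
    (hu : ∀ h, u h ≤ M * ‖(h : A)‖) :
    ∃ ν : A →ₗ[ℝ] ℝ, (∀ x, 0 ≤ x → 0 ≤ ν x) ∧ ν 1 ≤ 4 * M ∧
      ∀ z w : selfAdjoint A, -(w : A) ≤ z → (z : A) ≤ w → |u z| ≤ ν w := by
  obtain ⟨φ, ψ, hφ, hψ, rfl, hφ1, hψ1⟩ := exists_nonneg_sub_eq u hM hu
  have hre : ∀ w : selfAdjoint A, realPart (w : A) = w := fun w =>
    Subtype.ext (IsSelfAdjoint.coe_realPart w.2)
  refine ⟨(φ + ψ) ∘ₗ realPart, ?_, ?_, ?_⟩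
  · intro x hx
    have := hre ⟨x, IsSelfAdjoint.of_nonneg hx⟩
    simp only [LinearMap.comp_apply, LinearMap.add_apply]
    rw [this]
    exact add_nonneg (hφ _ hx) (hψ _ hx)
  · have := hre (1 : selfAdjoint A)
    simp only [selfAdjoint.val_one] at this
    simp only [LinearMap.comp_apply, LinearMap.add_apply, this]
    linarith
  · intro z w h1 h2
    simp only [LinearMap.comp_apply, LinearMap.add_apply, LinearMap.sub_apply, hre]
    have a1 := hφ (w - z) (by simpa using h2)
    have a2 := hψ (w - z) (by simpa using h2)
    have a3 := hφ (w + z) (by simpa using neg_le_iff_add_nonneg'.1 h1)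
    have a4 := hψ (w + z) (by simpa using neg_le_iff_add_nonneg'.1 h1)
    simp only [map_sub, map_add] at a1 a2 a3 a4
    rw [abs_le]
    constructor <;> linarith

/-- Every bounded functional is dominated by a positive real-linear functional. -/
theorem exists_dominating (f : A →L[ℂ] ℂ) :
    ∃ ν : A →ₗ[ℝ] ℝ, (∀ x, 0 ≤ x → 0 ≤ ν x) ∧ ν 1 ≤ 8 * ‖f‖ ∧
      ∀ z w : A, IsSelfAdjoint z → IsSelfAdjoint w → -w ≤ z → z ≤ w → ‖f z‖ ≤ ν w := by
  let F : selfAdjoint A →ₗ[ℝ] ℂ :=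
    (f.toLinearMap.restrictScalars ℝ) ∘ₗ (selfAdjoint.submodule ℝ A).subtype
  obtain ⟨ν₁, h1, h2, h3⟩ := exists_dominating_real (Complex.reLm ∘ₗ F) (norm_nonneg f)
    (fun h => (Complex.re_le_norm _).trans (f.le_opNorm _))
  obtain ⟨ν₂, k1, k2, k3⟩ := exists_dominating_real (Complex.imLm ∘ₗ F) (norm_nonneg f)
    (fun h => ((le_abs_self _).trans (Complex.abs_im_le_norm _)).trans (f.le_opNorm _))
  refine ⟨ν₁ + ν₂, fun x hx => add_nonneg (h1 x hx) (k1 x hx), ?_, ?_⟩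
  · simp only [LinearMap.add_apply]
    linarith
  · intro z w hz hw hzw1 hzw2
    refine (Complex.norm_le_abs_re_add_abs_im _).trans ?_
    exact add_le_add (h3 ⟨z, hz⟩ ⟨w, hw⟩ hzw1 hzw2) (k3 ⟨z, hz⟩ ⟨w, hw⟩ hzw1 hzw2)

end CStar

section Exhaustion
variable {A : Type*} [CStarAlgebra A] [PartialOrder A] [StarOrderedRing A]

theorem mul_self_le_one {a : A} (ha : 0 ≤ a) (ha1 : a ≤ 1) : a * a ≤ 1 := by
  have := CStarAlgebra.pow_antitone ha ha1 (Nat.zero_le 2)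
  simpa [pow_two] using this

theorem mul_self_le_self {a : A} (ha : 0 ≤ a) (ha1 : a ≤ 1) : a * a ≤ a := by
  have := CStarAlgebra.pow_antitone ha ha1 (show 1 ≤ 2 by norm_num)
  simpa [pow_two] using this

theorem monotone_of_nonneg {ν : A →ₗ[ℝ] ℝ} (hν : ∀ x, 0 ≤ x → 0 ≤ ν x) {x y : A} (h : x ≤ y) :
    ν x ≤ ν y := by
  have := hν (y - x) (sub_nonneg.2 h)
  rw [map_sub] at this
  linarith

theorem norm_conjugate_sub_le {f : A →L[ℂ] ℂ} {ν : A →ₗ[ℝ] ℝ}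
    (hf : ∀ z w : A, IsSelfAdjoint z → IsSelfAdjoint w → -w ≤ z → z ≤ w → ‖f z‖ ≤ ν w)
    {a c y : A} (hc : IsSelfAdjoint c) (ha : 0 ≤ a) (ha1 : a ≤ 1) (hy : IsSelfAdjoint y)
    (hy1 : y * y ≤ 1) {t : ℝ} (ht : 0 < t) :
    ‖f ((y - c) * a * (y - c)) - f (y * a * y)‖ ≤ (t + 1) * ν (c * c) + t⁻¹ * ν 1 := by
  have hasa : IsSelfAdjoint a := .of_nonneg ha
  obtain ⟨s, hs, rfl⟩ : ∃ s : ℝ, 0 < s ∧ s * s = t :=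
    ⟨√t, Real.sqrt_pos.2 ht, Real.mul_self_sqrt ht.le⟩
  have hyay : y * (a * a) * y ≤ 1 := by
    refine (hy.conjugate_le_conjugate (mul_self_le_one ha ha1)).trans ?_
    simpa using hy1
  have hcac : c * a * c ≤ c * c := by simpa using hc.conjugate_le_conjugate ha1
  have hcac0 : 0 ≤ c * a * c := hc.conjugate_nonneg ha
  have key : ∀ r : ℝ, star (s • c + r • (a * y)) * (s • c + r • (a * y)) =
      (s * s) • (c * c) + (s * r) • (c * a * y + y * a * c) + (r * r) • (y * (a * a) * y) := by
    intro r
    simp only [star_add, star_smul, star_mul, hc.star_eq, hasa.star_eq, hy.star_eq, mul_add,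
      add_mul, smul_mul_assoc, mul_smul_comm, smul_smul, smul_add, star_trivial, mul_assoc,
      mul_comm s r]
    abel
  have h1 : 0 ≤ (s * s) • (c * c) + (c * a * y + y * a * c) +
      (s * s)⁻¹ • (y * (a * a) * y) := by
    have := key s⁻¹
    rw [mul_inv_cancel₀ hs.ne', one_smul, ← mul_inv] at this
    exact this ▸ star_mul_self_nonneg _
  have h2 : 0 ≤ (s * s) • (c * c) - (c * a * y + y * a * c) +
      (s * s)⁻¹ • (y * (a * a) * y) := by
    have := key (-s⁻¹)
    rw [mul_neg, mul_inv_cancel₀ hs.ne', neg_one_smul ℝ, neg_mul_neg, ← mul_inv,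
      ← sub_eq_add_neg] at this
    exact this ▸ star_mul_self_nonneg _
  have h3 : 0 ≤ (s * s)⁻¹ • (1 - y * (a * a) * y) :=
    smul_nonneg (by positivity) (sub_nonneg.2 hyay)
  have hz : (y - c) * a * (y - c) - y * a * y = c * a * c - (c * a * y + y * a * c) := by
    noncomm_ring
  have hcc : IsSelfAdjoint (c * c) := by
    simpa [hc.star_eq] using IsSelfAdjoint.star_mul_self c
  have hzsa : IsSelfAdjoint (c * a * c - (c * a * y + y * a * c)) := by
    rw [isSelfAdjoint_iff]
    simp only [star_add, star_sub, star_mul, hc.star_eq, hasa.star_eq, hy.star_eq, mul_assoc]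
    rw [add_comm]
  rw [← map_sub, hz]
  have hW : (s * s + 1) * ν (c * c) + (s * s)⁻¹ * ν 1 =
      ν ((s * s + 1) • (c * c) + (s * s)⁻¹ • (1 : A)) := by simp
  rw [hW]
  refine hf _ _ hzsa (((IsSelfAdjoint.all _).smul hcc).add
    ((IsSelfAdjoint.all _).smul (.one A))) ?_ ?_
  · rw [neg_le_iff_add_nonneg']
    convert add_nonneg (add_nonneg (add_nonneg h2 h3) hcac0) (sub_nonneg.2 (hcac0.trans hcac))
      using 1
    simp only [add_smul, one_smul, smul_sub]
    abel
  · rw [← sub_nonneg]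
    convert add_nonneg (add_nonneg h1 h3) (sub_nonneg.2 hcac) using 1
    simp only [add_smul, one_smul, smul_sub]
    abel

/-- The sets `K n` of functionals keep mass greater than `δ` on elements of the order interval
`[0, 1]`, compressed by `1 - S`, that are arbitrarily small for any prescribed positive
functional. -/
def RetainsMass (K : ℕ → Set (A →L[ℂ] ℂ)) (δ : ℝ) (S : A) : Prop :=
  ∀ ω : A →ₗ[ℝ] ℝ, (∀ x, 0 ≤ x → 0 ≤ ω x) → ∀ n, ∃ f ∈ K n, ∃ a : A, 0 ≤ a ∧ a ≤ 1 ∧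
    ω (a * a) ≤ 1 ∧ δ < ‖f ((1 - S) * a * (1 - S))‖

theorem RetainsMass.exists_family {K : ℕ → Set (A →L[ℂ] ℂ)} {δ : ℝ} {S : A}
    (h : RetainsMass K δ S) (n N : ℕ) : ∀ δ' < δ,
    ∃ (b : Fin N → A) (f : Fin N → A →L[ℂ] ℂ), (∀ k, 0 ≤ b k) ∧ (∀ k, f k ∈ K n) ∧
      (∀ k, δ' < ‖f k ((1 - S) * b k * (1 - S))‖) ∧ ∑ k, b k ≤ 1 := by
  induction N with
  | zero => exact fun δ' _ => ⟨0, 0, by simp, by simp, by simp, by simp⟩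
  | succ N ih =>
    intro δ' hδ'
    obtain ⟨b, f, hb, hf, hfb, hsum⟩ := ih ((δ' + δ) / 2) (by linarith)
    have hb1 : ∀ k, b k ≤ 1 := fun k =>
      (Finset.single_le_sum (f := b) (fun i _ => hb i) (Finset.mem_univ k)).trans hsum
    let L : A →L[ℂ] A := (ContinuousLinearMap.mul ℂ A (1 - S)).comp
      ((ContinuousLinearMap.mul ℂ A).flip (1 - S))
    have hL : ∀ x, L x = (1 - S) * x * (1 - S) := fun x => (mul_assoc _ _ _).symm
    choose ν hν hν1 hνf using fun k => exists_dominating ((f k).comp L)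
    set η : ℝ := (δ - δ') / 2 with hη
    have hηpos : 0 < η := by rw [hη]; linarith
    have hone : ∀ k, 0 ≤ ν k 1 := fun k => hν k 1 zero_le_one
    set C : ℝ := ∑ k, ν k 1 + 1 with hC
    have hCpos : 0 < C := by
      have := Finset.sum_nonneg (s := Finset.univ) (fun k _ => hone k)
      rw [hC]; linarith
    have hCk : ∀ k, ν k 1 ≤ C := fun k => by
      have := Finset.single_le_sum (f := fun k => ν k 1) (fun i _ => hone i) (Finset.mem_univ k)
      rw [hC]; linarith
    set t : ℝ := 2 * C / η with ht
    have htpos : 0 < t := by positivity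
    obtain ⟨f₀, hf₀, a, ha, ha1, hωa, hfa⟩ := h (((t + 1) * 4 / η) • ∑ k, ν k)
      (fun x hx => by
        simp only [LinearMap.smul_apply, LinearMap.sum_apply, smul_eq_mul]
        exact mul_nonneg (by positivity) (Finset.sum_nonneg fun k _ => hν k x hx)) n
    have hasa : IsSelfAdjoint a := .of_nonneg ha
    have haa : 0 ≤ a * a := hasa.mul_self_nonneg
    have h1a : IsSelfAdjoint (1 - a) := (IsSelfAdjoint.one A).sub hasa
    have hνa : ∀ k, (t + 1) * ν k (a * a) ≤ η / 4 := by
      intro k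
      simp only [LinearMap.smul_apply, LinearMap.sum_apply, smul_eq_mul] at hωa
      have h2 := Finset.single_le_sum (f := fun k => ν k (a * a)) (fun i _ => hν i _ haa)
        (Finset.mem_univ k)
      have h3 : (t + 1) * 4 / η * ν k (a * a) ≤ 1 :=
        (mul_le_mul_of_nonneg_left h2 (by positivity)).trans hωa
      rw [div_mul_eq_mul_div, div_le_one hηpos] at h3
      linarith
    refine ⟨Fin.cons a fun k => (1 - a) * b k * (1 - a), Fin.cons f₀ f, ?_, ?_, ?_, ?_⟩
    · exact Fin.cases ha fun k => h1a.conjugate_nonneg (hb k)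
    · exact Fin.cases hf₀ hf
    · refine Fin.cases (by simpa using hδ'.trans hfa) fun k => ?_
      simp only [Fin.cons_succ]
      have h1 := norm_conjugate_sub_le (hνf k) hasa (hb k) (hb1 k) (.one A) (by simp) htpos
      have h2 : t⁻¹ * ν k 1 ≤ η / 2 := by
        have : t⁻¹ * C = η / 2 := by rw [ht]; field_simp
        rw [← this]
        exact mul_le_mul_of_nonneg_left (hCk k) (by positivity)
      simp only [ContinuousLinearMap.comp_apply, hL, one_mul, mul_one] at h1
      have h3 := norm_sub_norm_le (f k ((1 - S) * b k * (1 - S)))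
        (f k ((1 - S) * ((1 - a) * b k * (1 - a)) * (1 - S)))
      rw [norm_sub_rev] at h3
      have h4 := hfb k
      have h5 := hνa k
      linarith
    · rw [Fin.sum_univ_succ]
      simp only [Fin.cons_zero, Fin.cons_succ]
      rw [← Finset.sum_mul, ← Finset.mul_sum]
      calc a + (1 - a) * (∑ k, b k) * (1 - a) ≤ a + (1 - a) * 1 * (1 - a) := by
            gcongr
            exact h1a.conjugate_le_conjugate hsum
        _ = 1 + (a * a - a) := by noncomm_ring
        _ ≤ 1 + 0 := by
            gcongr
            exact sub_nonpos.2 (mul_self_le_self ha ha1)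
        _ = 1 := add_zero 1

theorem RetainsMass.exists_step {K : ℕ → Set (A →L[ℂ] ℂ)} (hK : Antitone K) {M : ℝ}
    (hM : ∀ n, ∀ f ∈ K n, ‖f‖ ≤ M) {δ δ' : ℝ} (hδ : δ' < δ) {S : A} (hS : 0 ≤ S) (hS1 : S ≤ 1)
    (h : RetainsMass K δ S) (n : ℕ) :
    ∃ S', S ≤ S' ∧ S' ≤ 1 ∧ RetainsMass K δ' S' ∧ ∃ f ∈ K n, δ' < ‖f (S' - S)‖ := by
  have hM0 : 0 ≤ M := by
    obtain ⟨f, hf, -⟩ := h 0 (by simp) 0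
    exact (norm_nonneg f).trans (hM 0 f hf)
  set η : ℝ := δ - δ' with hη
  have hηpos : 0 < η := sub_pos.2 hδ
  obtain ⟨t, htpos, ht⟩ : ∃ t : ℝ, 0 < t ∧ t⁻¹ * (8 * M) ≤ η / 2 := by
    refine ⟨(16 * M + 1) / η, by positivity, ?_⟩
    rw [inv_div, div_mul_eq_mul_div, div_le_iff₀ (by positivity)]
    nlinarith
  obtain ⟨N, hN⟩ : ∃ N : ℕ, (t + 1) * (8 * M) / (η / 2) < N := exists_nat_gt _
  have hNpos : (0 : ℝ) < N := lt_of_le_of_lt (by positivity) hN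
  obtain ⟨b, f, hb, hf, hfb, hsum⟩ := h.exists_family n N δ' hδ
  set y : A := 1 - S with hy
  have hy0 : 0 ≤ y := sub_nonneg.2 hS1
  have hy1 : y ≤ 1 := sub_le_self 1 hS
  have hysa : IsSelfAdjoint y := .of_nonneg hy0
  have hb1 : ∀ k, b k ≤ 1 := fun k =>
    (Finset.single_le_sum (f := b) (fun i _ => hb i) (Finset.mem_univ k)).trans hsum
  have hc0 : ∀ k, 0 ≤ y * b k * y := fun k => hysa.conjugate_nonneg (hb k)
  have hc1 : ∀ k, y * b k * y ≤ y := fun k => by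
    refine (hysa.conjugate_le_conjugate (hb1 k)).trans ?_
    simpa using mul_self_le_self hy0 hy1
  suffices hk : ∃ k, RetainsMass K δ' (S + y * b k * y) by
    obtain ⟨k, hk⟩ := hk
    refine ⟨S + y * b k * y, le_add_of_nonneg_right (hc0 k), ?_, hk, f k, hf k, ?_⟩
    · calc S + y * b k * y ≤ S + y := by gcongr; exact hc1 k
        _ = 1 := by rw [hy]; abel
    · simpa using hfb k
  by_contra! hcon
  unfold RetainsMass at hcon
  push Not at hcon
  choose ω hω m hωm using hcon
  obtain ⟨g, hg, a, ha, ha1, hωa, hga⟩ := h (∑ k, ω k)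
    (fun x hx => by
      rw [LinearMap.sum_apply]
      exact Finset.sum_nonneg fun k _ => hω k x hx) (Finset.univ.sup m)
  obtain ⟨ν, hν, hν1, hνg⟩ := exists_dominating g
  have hν1M : ν 1 ≤ 8 * M := hν1.trans (by linarith [hM _ g hg])
  have haa : 0 ≤ a * a := (IsSelfAdjoint.of_nonneg ha).mul_self_nonneg
  have hlow : ∀ k, η / 2 ≤ (t + 1) * ν (y * b k * y) := by
    intro k
    have h1 := hωm k g (hK (Finset.le_sup (Finset.mem_univ k)) hg) a ha ha1 (by
      rw [LinearMap.sum_apply] at hωa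
      exact (Finset.single_le_sum (f := fun k => ω k (a * a)) (fun i _ => hω i _ haa)
        (Finset.mem_univ k)).trans hωa)
    have h2 := norm_conjugate_sub_le hνg (.of_nonneg (hc0 k)) ha ha1 hysa
      (mul_self_le_one hy0 hy1) htpos
    rw [← sub_sub, ← hy] at h1
    have h3 := norm_sub_norm_le (g (y * a * y)) (g ((y - y * b k * y) * a * (y - y * b k * y)))
    rw [norm_sub_rev] at h3
    have h4 := monotone_of_nonneg hν (mul_self_le_self (hc0 k) ((hc1 k).trans hy1))
    have h5 := mul_le_mul_of_nonneg_left h4 (by positivity : 0 ≤ t + 1)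
    have h6 := mul_le_mul_of_nonneg_left hν1M (by positivity : 0 ≤ t⁻¹)
    linarith
  have hup : ∑ k, ν (y * b k * y) ≤ 8 * M := by
    rw [← map_sum, ← Finset.sum_mul, ← Finset.mul_sum]
    refine (monotone_of_nonneg hν ?_).trans hν1M
    refine (hysa.conjugate_le_conjugate hsum).trans ?_
    simpa using mul_self_le_one hy0 hy1
  have h1 : (N : ℝ) * (η / 2) ≤ (t + 1) * (8 * M) := by
    calc (N : ℝ) * (η / 2) = ∑ k : Fin N, η / 2 := by simp
      _ ≤ ∑ k, (t + 1) * ν (y * b k * y) := Finset.sum_le_sum fun k _ => hlow k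
      _ ≤ (t + 1) * (8 * M) := by
        rw [← Finset.mul_sum]
        exact mul_le_mul_of_nonneg_left hup (by positivity)
  rw [div_lt_iff₀ (by positivity)] at hN
  linarith

/-- A quantitative form of Pełczyński's property (V): sets of functionals that are not uniformly
absolutely continuous are detected along a sequence of positive elements with bounded sums. -/
theorem RetainsMass.exists_sequence {K : ℕ → Set (A →L[ℂ] ℂ)} (hK : Antitone K) {M : ℝ}
    (hM : ∀ n, ∀ f ∈ K n, ‖f‖ ≤ M) {δ : ℝ} (hδ : 0 < δ) (h : RetainsMass K δ 0) :
    ∃ (D : ℕ → A) (f : ℕ → A →L[ℂ] ℂ), (∀ n, 0 ≤ D n) ∧ (∀ n, f n ∈ K n) ∧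
      (∀ n, δ / 2 < ‖f n (D n)‖) ∧ ∀ n, ∑ j ∈ Finset.range n, D j ≤ 1 := by
  let d : ℕ → ℝ := fun n => δ / 2 + δ / 2 * (1 / 2) ^ n
  have hd : ∀ n, d (n + 1) < d n := fun n => by
    have : (0 : ℝ) < (1 / 2) ^ n := by positivity
    simp only [d, pow_succ]
    nlinarith
  let P : ℕ → A → Prop := fun n S => 0 ≤ S ∧ S ≤ 1 ∧ RetainsMass K (d n) S
  have step : ∀ n, ∀ S : {S // P n S}, ∃ S' : {S' // P (n + 1) S'}, S.1 ≤ S'.1 ∧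
      ∃ f ∈ K n, d (n + 1) < ‖f (S'.1 - S.1)‖ := by
    rintro n ⟨S, hS, hS1, hr⟩
    obtain ⟨S', h1, h2, h3, h4⟩ := hr.exists_step hK hM (hd n) hS hS1 n
    exact ⟨⟨S', hS.trans h1, h2, h3⟩, h1, h4⟩
  choose next hnext fn hfn hfn' using step
  let S : ∀ n, {S // P n S} := fun n =>
    Nat.rec ⟨0, le_rfl, zero_le_one, by simpa [d] using h⟩ next n
  refine ⟨fun n => (S (n + 1)).1 - (S n).1, fun n => fn n (S n),
    fun n => sub_nonneg.2 (hnext n (S n)), fun n => hfn n (S n), fun n => ?_, fun n => ?_⟩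
  · refine lt_trans ?_ (hfn' n (S n))
    simp only [d]
    have : (0 : ℝ) < (1 / 2) ^ (n + 1) := by positivity
    nlinarith
  · rw [Finset.sum_range_sub (fun n => (S n).1)]
    exact (sub_le_self _ (S 0).2.1).trans (S n).2.2.1

end Exhaustion

section Rosenthal

/-- Rosenthal's disjointness lemma for uniformly bounded finitely additive set functions. -/
theorem exists_infinite_offDiag_lt (ν : ℕ → Set ℕ → ℝ) (h0 : ∀ n E, 0 ≤ ν n E)
    (hadd : ∀ n E F, Disjoint E F → ν n (E ∪ F) = ν n E + ν n F) {C : ℝ} (hC : ∀ n E, ν n E ≤ C)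
    {η : ℝ} (hη : 0 < η) :
    ∃ M : Set ℕ, M.Infinite ∧ ∀ n ∈ M, ν n (M \ {n}) < η := by
  have hmono : ∀ n E F, E ⊆ F → ν n E ≤ ν n F := by
    intro n E F hEF
    have := hadd n E (F \ E) Set.disjoint_sdiff_right
    rw [Set.union_sdiff_cancel hEF] at this
    linarith [h0 n (F \ E)]
  have key : ∀ r : ℕ, ∀ M₀ : Set ℕ, M₀.Infinite → (∀ n ∈ M₀, ν n M₀ ≤ r * η) →
      ∃ M : Set ℕ, M.Infinite ∧ ∀ n ∈ M, ν n (M \ {n}) < η := by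
    intro r
    induction r with
    | zero =>
      intro M₀ hM₀ h
      refine ⟨M₀, hM₀, fun n hn => ?_⟩
      have h1 := hmono n _ _ (Set.sdiff_subset (s := M₀) (t := {n}))
      have h2 := h n hn
      simp only [Nat.cast_zero, zero_mul] at h2
      linarith
    | succ r ih =>
      intro M₀ hM₀ h
      let P : ℕ → Set ℕ := fun p => Set.range fun q => Nat.nth (· ∈ M₀) (Nat.pair p q)
      have hinj : Function.Injective (Nat.nth (· ∈ M₀)) := Nat.nth_injective hM₀
      have hPM : ∀ p, P p ⊆ M₀ := by
        rintro p _ ⟨q, rfl⟩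
        exact Nat.nth_mem_of_infinite hM₀ _
      have hPinf : ∀ p, (P p).Infinite := fun p => Set.infinite_range_of_injective fun q q' hq =>
        (Nat.pair_eq_pair.1 (hinj hq)).2
      have hPdisj : ∀ p p' n, n ∈ P p → n ∈ P p' → p = p' := by
        rintro p p' _ ⟨q, rfl⟩ ⟨q', hq⟩
        exact (Nat.pair_eq_pair.1 (hinj hq)).1.symm
      by_cases hgood : ∃ p, ∀ n ∈ P p, ν n (P p \ {n}) < η
      · obtain ⟨p, hp⟩ := hgood
        exact ⟨P p, hPinf p, hp⟩
      · push Not at hgood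
        choose k hkP hk using hgood
        have hkinj : Function.Injective k := fun p p' hp =>
          hPdisj p p' (k p) (hkP p) (hp ▸ hkP p')
        refine ih (Set.range k) (Set.infinite_range_of_injective hkinj) ?_
        rintro _ ⟨p, rfl⟩
        have hdis : Disjoint (Set.range k) (P p \ {k p}) := by
          rw [Set.disjoint_left]
          rintro _ ⟨p', rfl⟩ ⟨h1, h2⟩
          exact h2 (by rw [hPdisj p p' _ h1 (hkP p')]; rfl)
        have h1 := hadd (k p) _ _ hdis
        have h2 : ν (k p) (Set.range k ∪ P p \ {k p}) ≤ ν (k p) M₀ := by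
          refine hmono _ _ _ (Set.union_subset ?_ (Set.sdiff_subset.trans (hPM p)))
          rintro _ ⟨p', rfl⟩
          exact hPM p' (hkP p')
        have h3 := h (k p) (hPM p (hkP p))
        have h4 := hk p
        push_cast at h3
        linarith
  obtain ⟨r, hr⟩ := exists_nat_ge (C / η)
  rw [div_le_iff₀ hη] at hr
  exact key r Set.univ Set.infinite_univ fun n _ => (hC n _).trans hr

variable {A : Type*} [CStarAlgebra A] [PartialOrder A] [StarOrderedRing A]

/-- A Phillips-type lemma: functionals charging the atoms of a bounded finitely additive positive
measure uniformly cannot be null on all its values. -/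
theorem exists_not_tendsto_zero {f : ℕ → A →L[ℂ] ℂ} {M : ℝ} (hM : ∀ n, ‖f n‖ ≤ M)
    {Δ : Set ℕ → A} (h0 : ∀ E, 0 ≤ Δ E) (h1 : ∀ E, Δ E ≤ 1)
    (hadd : ∀ E F, Disjoint E F → Δ (E ∪ F) = Δ E + Δ F) {δ : ℝ} (hδ : 0 < δ)
    (hf : ∀ n, δ < ‖f n (Δ {n})‖) :
    ∃ E, ¬ Filter.Tendsto (fun n => f n (Δ E)) Filter.atTop (nhds 0) := by
  choose ν hν hν1 hνf using fun n => exists_dominating (f n)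
  obtain ⟨E, hE, hEν⟩ := exists_infinite_offDiag_lt (fun n E => ν n (Δ E))
    (fun n E => hν n _ (h0 E)) (fun n E F hEF => by simp only [hadd E F hEF, map_add])
    (C := 8 * M)
    (fun n E => (monotone_of_nonneg (hν n) (h1 E)).trans ((hν1 n).trans (by linarith [hM n])))
    (half_pos hδ)
  refine ⟨E, fun hlim => ?_⟩
  have hev := hlim.eventually (Metric.ball_mem_nhds (0 : ℂ) (half_pos hδ))
  obtain ⟨N, hN⟩ := Filter.eventually_atTop.1 hev
  obtain ⟨n, hn, hnN⟩ := hE.exists_gt N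
  have h2 := hN n hnN.le
  rw [dist_zero_right] at h2
  have h3 : Δ E = Δ {n} + Δ (E \ {n}) := by
    rw [← hadd _ _ Set.disjoint_sdiff_right,
      Set.union_sdiff_cancel (Set.singleton_subset_iff.2 hn)]
  have h4 : ‖f n (Δ (E \ {n}))‖ ≤ ν n (Δ (E \ {n})) :=
    hνf n _ _ (.of_nonneg (h0 _)) (.of_nonneg (h0 _))
      ((neg_nonpos.2 (h0 _)).trans (h0 _)) le_rfl
  have h5 := hEν n hn
  have h6 := hf n
  have h7 : ‖f n (Δ {n})‖ ≤ ‖f n (Δ E)‖ + ‖f n (Δ (E \ {n}))‖ := by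
    have : f n (Δ {n}) = f n (Δ E) - f n (Δ (E \ {n})) := by rw [h3, map_add]; abel
    rw [this]
    exact norm_sub_le _ _
  linarith

end Rosenthal

section Duality

/-- Every bounded operator on a nontrivial complex Banach space has an approximate eigenvalue. -/
theorem exists_approximate_eigenvalue {E : Type*} [NormedAddCommGroup E] [NormedSpace ℂ E]
    [CompleteSpace E] [Nontrivial E] (ρ : E →L[ℂ] E) :
    ∃ μ : ℂ, ∀ ε > 0, ∃ u : E, ‖u‖ = 1 ∧ ‖ρ u - μ • u‖ < ε := by
  have hne : (spectrum ℂ ρ).Nonempty := spectrum.nonempty ρ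
  have hcl : IsClosed (spectrum ℂ ρ) := spectrum.isClosed ρ
  have huniv : spectrum ℂ ρ ≠ Set.univ := fun h =>
    noncompact_univ ℂ (h ▸ spectrum.isCompact ρ)
  obtain ⟨μ, hμ⟩ := nonempty_frontier_iff.2 ⟨hne, huniv⟩
  refine ⟨μ, fun ε hε => ?_⟩
  by_contra! hcon
  have hbelow : ∀ u : E, ε * ‖u‖ ≤ ‖ρ u - μ • u‖ := by
    intro u
    rcases eq_or_ne u 0 with rfl | hu
    · simp
    have hu' : ‖u‖ ≠ 0 := norm_ne_zero_iff.2 hu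
    have h1 := hcon ((‖u‖⁻¹ : ℂ) • u) (by simp [norm_smul, hu'])
    rw [map_smul, smul_comm μ, ← smul_sub, norm_smul] at h1
    simp only [norm_inv, Complex.norm_real, norm_norm] at h1
    rwa [← div_eq_inv_mul, le_div_iff₀ (by positivity)] at h1
  rw [hcl.frontier_eq, Set.mem_sdiff] at hμ
  have hmem : μ ∈ closure (spectrum ℂ ρ)ᶜ := by
    rw [closure_compl]
    exact hμ.2
  obtain ⟨z, hz, hzμ⟩ := Metric.mem_closure_iff.1 hmem (ε / 2) (by positivity)
  rw [Set.mem_compl_iff, spectrum.notMem_iff] at hz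
  obtain ⟨U, hU⟩ := hz
  have hUinv : ‖(↑U⁻¹ : E →L[ℂ] E)‖ ≤ 2 / ε := by
    refine ContinuousLinearMap.opNorm_le_bound _ (by positivity) fun v => ?_
    set w := (↑U⁻¹ : E →L[ℂ] E) v with hw
    have hv : z • w - ρ w = v := by
      have : (↑U * ↑U⁻¹ : E →L[ℂ] E) v = v := by rw [U.mul_inv]; rfl
      rw [hU] at this
      simpa [Algebra.algebraMap_eq_smul_one, ← hw] using this
    have h1 := hbelow w
    have h2 : ρ w - μ • w = (z - μ) • w - v := by
      rw [← hv, sub_smul]; abel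
    have h3 : ‖(z - μ) • w - v‖ ≤ ε / 2 * ‖w‖ + ‖v‖ := by
      refine (norm_sub_le _ _).trans (add_le_add ?_ le_rfl)
      rw [norm_smul, ← dist_eq_norm, dist_comm]
      gcongr
    rw [div_mul_eq_mul_div, le_div_iff₀ hε]
    rw [h2] at h1
    linarith
  have hclose : ‖(algebraMap ℂ (E →L[ℂ] E) μ - ρ) - U‖ < ‖(↑U⁻¹ : E →L[ℂ] E)‖⁻¹ := by
    rw [hU, sub_sub_sub_cancel_right, ← map_sub, norm_algebraMap', ← dist_eq_norm]
    have hpos : 0 < ‖(↑U⁻¹ : E →L[ℂ] E)‖ := Units.norm_pos _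
    refine hzμ.trans_le ?_
    rw [← inv_div]
    exact inv_anti₀ hpos hUinv
  exact spectrum.mem_iff.1 hμ.1 (U.ofNearby _ hclose).isUnit

/-- A proper closed subspace is annihilated by a nonzero functional. -/
theorem exists_ne_zero_annihilator {Y : Type*} [NormedAddCommGroup Y] [NormedSpace ℂ Y]
    (R : Submodule ℂ Y) (hR : IsClosed (R : Set Y)) (hR' : R ≠ ⊤) :
    ∃ ψ : StrongDual ℂ Y, ψ ≠ 0 ∧ ∀ y ∈ R, ψ y = 0 := by
  have : IsClosed (R : Set Y) := hR
  obtain ⟨φ, hφ⟩ : ∃ φ, φ ∉ R := by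
    by_contra! hcon
    exact hR' (eq_top_iff.2 fun y _ => hcon y)
  have hne : ‖R.mkQL φ‖ ≠ 0 := by
    rw [norm_ne_zero_iff, Submodule.mkQL_apply, Submodule.mkQ_apply, Ne,
      Submodule.Quotient.mk_eq_zero]
    exact hφ
  obtain ⟨g, -, hg⟩ := exists_dual_vector ℂ (R.mkQL φ) hne
  refine ⟨g.comp R.mkQL, fun h0 => ?_, fun y hy => ?_⟩
  · have : g (R.mkQL φ) = 0 := by
      simpa using congrArg (fun k => k φ) h0
    rw [hg] at this
    exact hne (RCLike.ofReal_eq_zero.1 this)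
  · have hx : R.mkQL y = 0 := by
      rwa [Submodule.mkQL_apply, Submodule.mkQ_apply, Submodule.Quotient.mk_eq_zero]
    rw [ContinuousLinearMap.comp_apply, hx, map_zero]

/-- An operator leaving a proper closed subspace invariant has approximate eigenfunctionals that
annihilate the subspace. -/
theorem exists_approximate_annihilator {Y : Type*} [NormedAddCommGroup Y] [NormedSpace ℂ Y]
    (R : Submodule ℂ Y) (hR : IsClosed (R : Set Y)) (hR' : R ≠ ⊤) (S : Y →L[ℂ] Y)
    (hS : ∀ y ∈ R, S y ∈ R) :
    ∃ μ : ℂ, ∀ ε > 0, ∃ (ψ : StrongDual ℂ Y) (φ : Y), (∀ y, ‖ψ y‖ ≤ ‖y‖) ∧ ‖φ‖ ≤ 1 ∧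
      1 / 2 < ‖ψ φ‖ ∧ (∀ y ∈ R, ψ y = 0) ∧ ∀ y, ‖ψ (S y - μ • y)‖ ≤ ε * ‖y‖ := by
  let E : Submodule ℂ (StrongDual ℂ Y) := LinearMap.ker (R.subtypeL.precomp ℂ).toLinearMap
  have hmem : ∀ ψ, ψ ∈ E ↔ ∀ y ∈ R, ψ y = 0 := fun ψ =>
    ContinuousLinearMap.ext_iff.trans ⟨fun h y hy => h ⟨y, hy⟩, fun h y => h y.1 y.2⟩
  have hcl : IsClosed (E : Set (StrongDual ℂ Y)) :=
    ContinuousLinearMap.isClosed_ker (R.subtypeL.precomp ℂ)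
  have : CompleteSpace E := hcl.completeSpace_coe
  obtain ⟨ψ₀, hψ₀, hψ₀E⟩ := exists_ne_zero_annihilator R hR hR'
  have : Nontrivial E :=
    ⟨⟨ψ₀, (hmem _).2 hψ₀E⟩, 0, fun h0 => hψ₀ (congrArg Subtype.val h0)⟩
  let ρ : E →L[ℂ] E := ((S.precomp ℂ).comp E.subtypeL).codRestrict E
    (fun ψ => (hmem _).2 fun y hy => (hmem _).1 ψ.2 (S y) (hS y hy))
  obtain ⟨μ, hμ⟩ := exists_approximate_eigenvalue (E := E) ρ
  refine ⟨μ, fun ε hε => ?_⟩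
  obtain ⟨ψ, h1, h2⟩ := hμ ε hε
  have h1' : ‖ψ.1‖ = 1 := h1
  obtain ⟨φ, hφ, hψφ⟩ := ψ.1.exists_lt_apply_of_lt_opNorm (r := 1 / 2) (by rw [h1']; norm_num)
  refine ⟨ψ, φ, fun y => ?_, hφ.le, hψφ, (hmem _).1 ψ.2, fun y => ?_⟩
  · simpa using ψ.1.le_of_opNorm_le h1'.le y
  have h3 := (ρ ψ - μ • ψ).1.le_of_opNorm_le h2.le y
  have h4 : (ρ ψ - μ • ψ).1 y = ψ.1 (S y - μ • y) := by
    simp [ρ]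
  rwa [h4] at h3

end Duality

section Helly

/-- A Helly-type selection: a functional `ψ` on the dual that almost annihilates the range of the
adjoint of `S` and is large at `φ` yields vectors at which `φ` is large and `S` is small. -/
theorem exists_vector_of_bidual {W : Type*} [NormedAddCommGroup W] [NormedSpace ℂ W]
    (S : W →L[ℂ] W) {ε : ℝ} (hε : 0 < ε) (ψ : StrongDual ℂ W →ₗ[ℂ] ℂ)
    (hψ : ∀ α, ‖ψ α‖ ≤ ‖α‖) (hψS : ∀ α : StrongDual ℂ W, ‖ψ (α.comp S)‖ ≤ ε * ‖α‖)
    {φ : StrongDual ℂ W} (hφ : 1 / 2 < ‖ψ φ‖) :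
    ∃ f : W, ‖f‖ ≤ 1 ∧ ‖S f‖ ≤ ε ∧ 1 / 4 < ‖φ f‖ := by
  by_contra! hcon
  let L : W →L[ℂ] W × W := (ContinuousLinearMap.id ℂ W).prod (((ε⁻¹ : ℝ) : ℂ) • S)
  have hbound : ∀ f, ‖φ f‖ ≤ 1 / 4 * ‖L f‖ := by
    intro f
    rcases eq_or_ne f 0 with rfl | hf
    · simp
    have hLf : 0 < ‖L f‖ := (norm_pos_iff.2 hf).trans_le (norm_fst_le (L f))
    have h1 : ‖f‖ ≤ ‖L f‖ := norm_fst_le (L f)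
    have h2 : ε⁻¹ * ‖S f‖ ≤ ‖L f‖ := by
      simp [L, norm_smul, abs_of_pos hε]
    have h3 := hcon ((‖L f‖⁻¹ : ℂ) • f)
      (by
        rw [norm_smul, norm_inv, Complex.norm_real, norm_norm, ← div_eq_inv_mul]
        exact (div_le_one hLf).2 h1)
      (by
        rw [map_smul, norm_smul, norm_inv, Complex.norm_real, norm_norm, ← div_eq_inv_mul,
          div_le_iff₀ hLf]
        rwa [← div_eq_inv_mul, div_le_iff₀' hε] at h2)
    rw [map_smul, norm_smul, norm_inv, Complex.norm_real, norm_norm, ← div_eq_inv_mul,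
      div_le_iff₀ hLf] at h3
    exact h3
  let p : Submodule ℂ (W × W) := LinearMap.range L.toLinearMap
  let u : StrongDual ℂ p := LinearMap.mkContinuous
    ((φ.toLinearMap ∘ₗ LinearMap.fst ℂ W W).domRestrict p) (1 / 4) (by
      rintro ⟨_, f, rfl⟩
      exact hbound f)
  obtain ⟨g, hg, hgn⟩ := exists_extension_norm_eq p u
  have hg4 : ‖g‖ ≤ 1 / 4 := hgn ▸ LinearMap.mkContinuous_norm_le _ (by norm_num) _
  let α : StrongDual ℂ W := g.comp (.inl ℂ W W)
  let β : StrongDual ℂ W := g.comp (.inr ℂ W W)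
  have hα : ‖α‖ ≤ 1 / 4 := by
    refine ContinuousLinearMap.opNorm_le_bound _ (by norm_num) fun x => ?_
    refine (g.le_of_opNorm_le hg4 (x, 0)).trans_eq ?_
    simp [Prod.norm_def]
  have hβ : ‖β‖ ≤ 1 / 4 := by
    refine ContinuousLinearMap.opNorm_le_bound _ (by norm_num) fun x => ?_
    refine (g.le_of_opNorm_le hg4 (0, x)).trans_eq ?_
    simp [Prod.norm_def]
  have hdec : φ = α + ((ε⁻¹ : ℝ) : ℂ) • β.comp S := by
    ext f
    have h1 : g (L f) = φ f := hg ⟨L f, f, rfl⟩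
    have h2 : L f = (f, 0) + (0, ((ε⁻¹ : ℝ) : ℂ) • S f) := by simp [L]
    have h3 : ((0 : W), ((ε⁻¹ : ℝ) : ℂ) • S f) = ((ε⁻¹ : ℝ) : ℂ) • ((0 : W), S f) := by simp
    rw [← h1, h2, map_add, h3, map_smul]
    rfl
  have h1 : ‖ψ φ‖ ≤ 1 / 4 + ε⁻¹ * (ε * (1 / 4)) := by
    rw [hdec, map_add, map_smul]
    refine (norm_add_le _ _).trans (add_le_add ((hψ α).trans hα) ?_)
    rw [norm_smul, Complex.norm_real, Real.norm_of_nonneg (by positivity)]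
    gcongr
    exact (hψS β).trans (by gcongr)
  rw [inv_mul_cancel_left₀ hε.ne'] at h1
  linarith

/-- Helly's theorem: a bidual functional of norm at most one is approximated on finite sets by
vectors of the unit ball. -/
theorem exists_approx_bidual {X : Type*} [NormedAddCommGroup X] [NormedSpace ℂ X]
    (φ : StrongDual ℂ (StrongDual ℂ X)) (hφ : ∀ f, ‖φ f‖ ≤ ‖f‖) (F : Finset (StrongDual ℂ X))
    {η : ℝ} (hη : 0 < η) : ∃ x : X, ‖x‖ ≤ 1 ∧ ∀ f ∈ F, ‖f x - φ f‖ ≤ η := by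
  classical
  let m : X →L[ℂ] (F → ℂ) := ContinuousLinearMap.pi fun f => f.1
  let v : F → ℂ := fun f => φ f.1
  suffices hv : v ∈ closure (m '' Metric.closedBall 0 1) by
    obtain ⟨_, ⟨x, hx, rfl⟩, hxv⟩ := Metric.mem_closure_iff.1 hv η hη
    refine ⟨x, by simpa using hx, fun f hf => ?_⟩
    rw [dist_comm, dist_eq_norm] at hxv
    exact ((norm_le_pi_norm (m x - v) ⟨f, hf⟩).trans_lt hxv).le
  by_contra hv
  have hconv : Convex ℝ (closure (m '' Metric.closedBall 0 1)) :=
    ((convex_closedBall (0 : X) 1).linear_image (m.toLinearMap.restrictScalars ℝ)).closure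
  obtain ⟨u, s, hus, hsv⟩ := RCLike.geometric_hahn_banach_closed_point (𝕜 := ℂ) hconv
    isClosed_closure hv
  have hs : 0 < s := by
    have := hus 0 (subset_closure ⟨0, by simp, by simp⟩)
    simpa using this
  have hu : ‖u.comp m‖ ≤ s := by
    refine ContinuousLinearMap.opNorm_le_of_unit_norm hs.le fun x hx => ?_
    set c : ℂ := u.comp m x with hc
    rcases eq_or_ne c 0 with h0 | h0
    · simpa [h0] using hs.le
    have hc0 : (‖c‖ : ℂ) ≠ 0 := by simpa using h0
    have h1 := hus (m ((starRingEnd ℂ c / ‖c‖) • x)) (subset_closure ⟨_, by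
      simp [norm_smul, hx, h0], rfl⟩)
    have h2 : u (m ((starRingEnd ℂ c / ‖c‖) • x)) = ‖c‖ := by
      rw [map_smul, map_smul, smul_eq_mul, ← ContinuousLinearMap.comp_apply, ← hc,
        div_mul_eq_mul_div, Complex.conj_mul', div_eq_iff hc0, sq]
    rw [h2] at h1
    exact h1.le
  have huv : φ (u.comp m) = u v := by
    have h1 : ∀ w, u w = ∑ f, w f • u (Pi.single f 1) := by
      intro w
      refine (LinearMap.pi_apply_eq_sum_univ u.toLinearMap w).trans ?_
      refine Finset.sum_congr rfl fun i _ => ?_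
      refine congrArg (fun z => w i • u z) ?_
      ext j
      simp [Pi.single_apply, eq_comm]
    have h2 : u.comp m = ∑ f : F, u (Pi.single f 1) • f.1 := by
      ext x
      rw [ContinuousLinearMap.comp_apply, h1]
      simp [m, mul_comm]
    rw [h2, map_sum, h1]
    simp [v, mul_comm]
  have h3 := (Complex.re_le_norm _).trans ((hφ (u.comp m)).trans hu)
  rw [huv] at h3
  exact absurd hsv (not_lt.2 h3)

end Helly

section Selection

/-- Almost-minimal approximants of a bidual functional with respect to a bounded quadratic form. -/
theorem exists_almost_minimal {V X : Type*} [NormedAddCommGroup V] [NormedSpace ℝ V]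
    [NormedAddCommGroup X] [NormedSpace ℂ X] (q : V →ₗ[ℝ] X) {C : ℝ}
    (hC : ∀ x : X, ‖x‖ ≤ 1 → ∃ a, q a = x ∧ ‖a‖ ≤ C)
    (N : V → ℝ) (hN0 : ∀ a, 0 ≤ N a) {B : ℝ} (hNB : ∀ a, ‖a‖ ≤ C → N a ≤ B)
    (hNpar : ∀ a b, N (b - a) = 2 * N a + 2 * N b - 4 * N ((1 / 2 : ℝ) • (a + b)))
    (φ : StrongDual ℂ (StrongDual ℂ X)) (hφ : ∀ f, ‖φ f‖ ≤ ‖f‖) {κ η : ℝ} (hκ : 0 < κ)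
    (hη : 0 < η) :
    ∃ a, ‖a‖ ≤ C ∧ ∀ f : StrongDual ℂ X, ∃ b, ‖b‖ ≤ C ∧ ‖f (q b) - φ f‖ ≤ κ ∧
      N (b - a) ≤ η := by
  classical
  let G : Finset (StrongDual ℂ X) → Set V := fun F =>
    {a | ‖a‖ ≤ C ∧ ∀ f ∈ F, ‖f (q a) - φ f‖ ≤ κ}
  have hGne : ∀ F, (G F).Nonempty := fun F => by
    obtain ⟨x, hx, hxF⟩ := exists_approx_bidual φ hφ F hκ
    obtain ⟨a, rfl, ha⟩ := hC x hx
    exact ⟨a, ha, hxF⟩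
  have hGmid : ∀ F, ∀ a ∈ G F, ∀ b ∈ G F, (1 / 2 : ℝ) • (a + b) ∈ G F := by
    rintro F a ⟨ha, haF⟩ b ⟨hb, hbF⟩
    refine ⟨?_, fun f hf => ?_⟩
    · rw [norm_smul, Real.norm_of_nonneg (by norm_num)]
      linarith [norm_add_le a b]
    · have h1 : f (q ((1 / 2 : ℝ) • (a + b))) - φ f =
          (1 / 2 : ℝ) • ((f (q a) - φ f) + (f (q b) - φ f)) := by
        rw [map_smul, map_add, map_real_smul f f.continuous, map_add]
        simp only [Complex.real_smul]
        push_cast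
        ring
      rw [h1, norm_smul, Real.norm_of_nonneg (by norm_num)]
      linarith [norm_add_le (f (q a) - φ f) (f (q b) - φ f), haF f hf, hbF f hf]
  let r : Finset (StrongDual ℂ X) → ℝ := fun F => sInf (N '' G F)
  have hbdd : ∀ F, BddBelow (N '' G F) := fun F => ⟨0, by rintro _ ⟨a, -, rfl⟩; exact hN0 a⟩
  have hrle : ∀ F, ∀ a ∈ G F, r F ≤ N a := fun F a ha => csInf_le (hbdd F) ⟨a, ha, rfl⟩
  have hrB : BddAbove (Set.range r) := ⟨B, by
    rintro _ ⟨F, rfl⟩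
    obtain ⟨a, ha⟩ := hGne F
    exact (hrle F a ha).trans (hNB a ha.1)⟩
  have hnear : ∀ F, ∃ a ∈ G F, N a < r F + η / 8 := fun F => by
    obtain ⟨_, ⟨a, ha, rfl⟩, h⟩ := exists_lt_of_csInf_lt ((hGne F).image N)
      (lt_add_of_pos_right (r F) (by positivity : 0 < η / 8))
    exact ⟨a, ha, h⟩
  obtain ⟨F, hF⟩ := exists_lt_of_lt_ciSup (sub_lt_self (⨆ F, r F) (by positivity : 0 < η / 8))
  obtain ⟨a, ha, haN⟩ := hnear F
  refine ⟨a, ha.1, fun f => ?_⟩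
  obtain ⟨b, hb, hbN⟩ := hnear (insert f F)
  refine ⟨b, hb.1, hb.2 f (Finset.mem_insert_self f F), ?_⟩
  have hbF : b ∈ G F := ⟨hb.1, fun g hg => hb.2 g (Finset.mem_insert_of_mem hg)⟩
  have h1 := hrle F _ (hGmid F a ha b hbF)
  have h2 := le_ciSup hrB (insert f F)
  rw [hNpar]
  linarith

end Selection

section Mass
open scoped ComplexStarModule
variable {A : Type*} [CStarAlgebra A] [PartialOrder A] [StarOrderedRing A]

theorem apply_mul_self_le {ω : A →ₗ[ℝ] ℝ} (hω : ∀ x, 0 ≤ x → 0 ≤ ω x) {h : A}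
    (hh : IsSelfAdjoint h) : ω (h * h) ≤ ‖h‖ * ‖h‖ * ω 1 := by
  have h1 : IsSelfAdjoint (h * h) := by simpa [hh.star_eq] using IsSelfAdjoint.star_mul_self h
  have h2 := monotone_of_nonneg hω (IsSelfAdjoint.le_algebraMap_norm_self h1)
  rw [Algebra.algebraMap_eq_smul_one, map_smul, smul_eq_mul] at h2
  exact h2.trans (mul_le_mul_of_nonneg_right (norm_mul_le h h) (hω 1 zero_le_one))

/-- A functional large on an element of small quadratic size is large on a positive element of
small quadratic size. -/
theorem exists_nonneg_of_quadratic (f : A →L[ℂ] ℂ) {ω : A →ₗ[ℝ] ℝ}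
    (hω : ∀ x, 0 ≤ x → 0 ≤ ω x) (c : A) :
    ∃ a : A, 0 ≤ a ∧ ‖a‖ ≤ ‖c‖ ∧ ω (a * a) ≤ ω (ℜ c * ℜ c : A) + ω (ℑ c * ℑ c : A) ∧
      ‖f c‖ ≤ 4 * ‖f a‖ := by
  have hsa : ∀ h : selfAdjoint A, ∃ a : A, 0 ≤ a ∧ ‖a‖ ≤ ‖h‖ ∧ ω (a * a) ≤ ω (h * h : A) ∧
      ‖f h‖ ≤ 2 * ‖f a‖ := by
    rintro ⟨h, hh⟩
    have hdec : h⁺ - h⁻ = h := CFC.posPart_sub_negPart h hh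
    have hsq : h * h = h⁺ * h⁺ + h⁻ * h⁻ := by
      nth_rewrite 1 2 [← hdec]
      simp only [mul_sub, sub_mul, CFC.posPart_mul_negPart, CFC.negPart_mul_posPart]
      abel
    have hp : 0 ≤ ω (h⁺ * h⁺) := hω _ (IsSelfAdjoint.of_nonneg (CFC.posPart_nonneg h)).mul_self_nonneg
    have hn : 0 ≤ ω (h⁻ * h⁻) := hω _ (IsSelfAdjoint.of_nonneg (CFC.negPart_nonneg h)).mul_self_nonneg
    have hf : ‖f h‖ ≤ ‖f h⁺‖ + ‖f h⁻‖ := by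
      nth_rewrite 1 [← hdec]
      rw [map_sub]
      exact norm_sub_le _ _
    simp only [hsq, map_add]
    rcases le_total ‖f h⁺‖ ‖f h⁻‖ with hle | hle
    · exact ⟨h⁻, CFC.negPart_nonneg h, CStarAlgebra.norm_negPart_le h, by linarith, by linarith⟩
    · exact ⟨h⁺, CFC.posPart_nonneg h, CStarAlgebra.norm_posPart_le h, by linarith, by linarith⟩
  have hf : ‖f c‖ ≤ ‖f (ℜ c)‖ + ‖f (ℑ c)‖ := by
    nth_rewrite 1 [← realPart_add_I_smul_imaginaryPart c]
    rw [map_add, map_smul]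
    refine (norm_add_le _ _).trans_eq ?_
    simp
  have hr : 0 ≤ ω (ℜ c * ℜ c : A) := hω _ (ℜ c).2.mul_self_nonneg
  have hi : 0 ≤ ω (ℑ c * ℑ c : A) := hω _ (ℑ c).2.mul_self_nonneg
  obtain ⟨a, ha, ha1, ha2, ha3⟩ := hsa (ℜ c)
  obtain ⟨b, hb, hb1, hb2, hb3⟩ := hsa (ℑ c)
  rcases le_total ‖f (ℜ c)‖ ‖f (ℑ c)‖ with hle | hle
  · exact ⟨b, hb, hb1.trans (imaginaryPart.norm_le c), by linarith, by linarith⟩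
  · exact ⟨a, ha, ha1.trans (realPart.norm_le c), by linarith, by linarith⟩

theorem retainsMass_of_bidual {X : Type*} [NormedAddCommGroup X] [NormedSpace ℂ X]
    (q : A →L[ℂ] X) {C : ℝ} (hC0 : 0 < C) (hC : ∀ x : X, ‖x‖ ≤ 1 → ∃ a, q a = x ∧ ‖a‖ ≤ C)
    (S : StrongDual ℂ X →L[ℂ] StrongDual ℂ X)
    (h : ∀ ε > 0, ∃ (ψ : StrongDual ℂ (StrongDual ℂ X) →ₗ[ℂ] ℂ)
      (φ : StrongDual ℂ (StrongDual ℂ X)), (∀ α, ‖ψ α‖ ≤ ‖α‖) ∧ (∀ f, ‖φ f‖ ≤ ‖f‖) ∧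
      1 / 2 < ‖ψ φ‖ ∧ (∀ x, ψ (inclusionInDoubleDual ℂ X x) = 0) ∧
      ∀ α : StrongDual ℂ (StrongDual ℂ X), ‖ψ (α.comp S)‖ ≤ ε * ‖α‖) :
    RetainsMass (fun n : ℕ => {F : A →L[ℂ] ℂ | ∃ g : StrongDual ℂ X, ‖g‖ ≤ 1 ∧
      ‖S g‖ ≤ 1 / ((n : ℝ) + 1) ∧ F = g.comp q}) (1 / (64 * C)) 0 := by
  intro ω hω n
  have hε : (0 : ℝ) < 1 / ((n : ℝ) + 1) := by positivity
  obtain ⟨ψ, φ, hψ, hφ, hψφ, hψι, hψS⟩ := h _ hε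
  let N : A → ℝ := fun x => ω (ℜ x * ℜ x : A) + ω (ℑ x * ℑ x : A)
  obtain ⟨a, ha, hab⟩ := exists_almost_minimal (V := A) (q.toLinearMap.restrictScalars ℝ) hC N
    (fun x => add_nonneg (hω _ (ℜ x).2.mul_self_nonneg) (hω _ (ℑ x).2.mul_self_nonneg))
    (B := 2 * (C * C * ω 1))
    (fun x hx => by
      have h1 := apply_mul_self_le hω (ℜ x).2
      have h2 := apply_mul_self_le hω (ℑ x).2
      have h3 : ‖(ℜ x : A)‖ ≤ C := (realPart.norm_le x).trans hx
      have h4 : ‖(ℑ x : A)‖ ≤ C := (imaginaryPart.norm_le x).trans hx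
      have h5 := mul_le_mul_of_nonneg_right
        (mul_le_mul h3 h3 (norm_nonneg _) hC0.le) (hω 1 zero_le_one)
      have h6 := mul_le_mul_of_nonneg_right
        (mul_le_mul h4 h4 (norm_nonneg _) hC0.le) (hω 1 zero_le_one)
      simp only [N]
      linarith)
    (fun x y => by
      simp only [N, map_sub, map_add, map_smul, AddSubgroupClass.coe_sub, AddMemClass.coe_add,
        selfAdjoint.val_smul, sub_mul, mul_sub, add_mul, mul_add, smul_mul_assoc,
        mul_smul_comm, smul_eq_mul]
      ring)
    φ hφ (κ := 1 / 16) (by norm_num) (η := 4 * C * C) (by positivity)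
  obtain ⟨f, hf1, hf2, hf3⟩ := exists_vector_of_bidual S hε ψ hψ hψS
    (φ := φ - inclusionInDoubleDual ℂ X (q a)) (by rwa [map_sub, hψι, sub_zero])
  obtain ⟨b, hb, hbf, hbN⟩ := hab f
  obtain ⟨c, hc, hc1, hc2, hc3⟩ := exists_nonneg_of_quadratic (f.comp q) hω (b - a)
  have hcn : ‖c‖ ≤ 2 * C := hc1.trans ((norm_sub_le b a).trans (by linarith))
  have hC2 : (0 : ℝ) < (2 * C)⁻¹ := by positivity
  have hfc : 3 / 64 ≤ ‖f (q c)‖ := by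
    simp only [ContinuousLinearMap.comp_apply, map_sub] at hc3
    have h1 : φ f - f (q a) = (f (q b) - f (q a)) - (f (q b) - φ f) := by ring
    have h2 : 1 / 4 < ‖φ f - f (q a)‖ := by simpa using hf3
    rw [h1] at h2
    have h3 := norm_sub_le (f (q b) - f (q a)) (f (q b) - φ f)
    have h4 : ‖f (q b) - φ f‖ ≤ 1 / 16 := hbf
    linarith
  refine ⟨f.comp q, ⟨f, hf1, hf2, rfl⟩, (2 * C)⁻¹ • c, smul_nonneg hC2.le hc, ?_, ?_, ?_⟩
  · have h1 : ‖(2 * C)⁻¹ • c‖ ≤ 1 := by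
      rw [norm_smul, Real.norm_of_nonneg hC2.le, ← div_eq_inv_mul]
      exact (div_le_one (by positivity)).2 hcn
    exact (CStarAlgebra.norm_le_one_iff_of_nonneg _ (smul_nonneg hC2.le hc)).1 h1
  · rw [smul_mul_smul_comm, map_smul, smul_eq_mul, ← mul_inv, ← div_eq_inv_mul,
      div_le_one (by positivity)]
    refine (hc2.trans hbN).trans_eq ?_
    ring
  · have h1 : (1 - 0) * ((2 * C)⁻¹ • c) * (1 - 0) = (2 * C)⁻¹ • c := by simp
    rw [h1, map_real_smul (f.comp q) (f.comp q).continuous, norm_smul,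
      Real.norm_of_nonneg hC2.le]
    calc 1 / (64 * C) < (2 * C)⁻¹ * (3 / 64) := by
          rw [← sub_pos]
          have : (2 * C)⁻¹ * (3 / 64) - 1 / (64 * C) = 1 / (128 * C) := by field_simp; norm_num
          rw [this]
          positivity
      _ ≤ _ := by gcongr; exact hfc

end Mass

section Transitive

theorem TopologicallyTransitive.eq_zero_of_comp_eq_smul {X : Type*} [NormedAddCommGroup X]
    [NormedSpace ℂ X] {T : X →L[ℂ] X} (hT : TopologicallyTransitive T) {f : StrongDual ℂ X} {μ : ℂ}
    (hf : ∀ x, f (T x) = μ * f x) : f = 0 := by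
  by_contra hne
  obtain ⟨x, hx⟩ : ∃ x, f x ≠ 0 := by
    by_contra! hcon
    exact hne (ContinuousLinearMap.ext hcon)
  have hpow : ∀ (n : ℕ) y, f ((T ^ n) y) = μ ^ n * f y := by
    intro n
    induction n with
    | zero => simp
    | succ n ih =>
      intro y
      rw [pow_succ', mul_apply_eq_comp, hf, ih, pow_succ']
      ring
  have ho1 : IsOpen {y | ‖f y‖ < 1} := isOpen_lt f.continuous.norm continuous_const
  have ho2 : IsOpen {y | 1 < ‖f y‖} := isOpen_lt continuous_const f.continuous.norm
  have hn1 : {y | ‖f y‖ < 1}.Nonempty := ⟨0, by simp⟩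
  have hn2 : {y | 1 < ‖f y‖}.Nonempty := ⟨(2 / f x) • x, by simp [hx]⟩
  rcases le_or_gt ‖μ‖ 1 with hμ | hμ
  · obtain ⟨n, -, _, ⟨y, hy, rfl⟩, hy'⟩ := hT _ _ ho1 ho2 hn1 hn2
    simp only [Set.mem_ofPred_eq, hpow, norm_mul, norm_pow] at hy hy'
    have := mul_le_mul_of_nonneg_right (pow_le_one₀ (norm_nonneg μ) hμ (n := n)) (norm_nonneg (f y))
    linarith
  · obtain ⟨n, -, _, ⟨y, hy, rfl⟩, hy'⟩ := hT _ _ ho2 ho1 hn2 hn1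
    simp only [Set.mem_ofPred_eq, hpow, norm_mul, norm_pow] at hy hy'
    have := mul_le_mul_of_nonneg_right (one_le_pow₀ hμ.le (n := n)) (norm_nonneg (f y))
    linarith

/-- Approximate eigenfunctionals of a transitive operator tend to zero pointwise. -/
theorem TopologicallyTransitive.tendsto_zero {X : Type*} [NormedAddCommGroup X]
    [NormedSpace ℂ X] {T : X →L[ℂ] X} (hT : TopologicallyTransitive T) (μ : ℂ)
    {g : ℕ → StrongDual ℂ X} (hg : ∀ n, ‖g n‖ ≤ 1)
    (hgT : ∀ n y, ‖g n (T y - μ • y)‖ ≤ 1 / ((n : ℝ) + 1) * ‖y‖) (x : X) :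
    Filter.Tendsto (fun n => g n x) Filter.atTop (nhds 0) := by
  let R : Submodule ℂ X := (LinearMap.range (T - μ • .id ℂ X).toLinearMap).topologicalClosure
  have hR : R = ⊤ := by
    by_contra hne
    obtain ⟨f, hf0, hf⟩ := exists_ne_zero_annihilator R
      (Submodule.isClosed_topologicalClosure _) hne
    refine hf0 (hT.eq_zero_of_comp_eq_smul (μ := μ) fun y => ?_)
    have h1 := hf (T y - μ • y) (Submodule.le_topologicalClosure _ ⟨y, by simp⟩)
    rwa [map_sub, map_smul, smul_eq_mul, sub_eq_zero] at h1
  have hx : x ∈ closure (Set.range fun y => T y - μ • y) := by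
    have : x ∈ R := hR ▸ Submodule.mem_top
    exact this
  rw [Metric.tendsto_atTop]
  intro ε hε
  obtain ⟨_, ⟨y, rfl⟩, hy⟩ := Metric.mem_closure_iff.1 hx (ε / 2) (by positivity)
  obtain ⟨m, hm⟩ := exists_nat_gt (‖y‖ / (ε / 2))
  refine ⟨m, fun n hn => ?_⟩
  rw [dist_zero_right]
  have h1 : g n x = g n (x - (T y - μ • y)) + g n (T y - μ • y) := by rw [← map_add]; simp
  have h2 : ‖g n (x - (T y - μ • y))‖ < ε / 2 := by
    refine ((g n).le_of_opNorm_le (hg n) _).trans_lt ?_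
    rw [one_mul, ← dist_eq_norm]
    exact hy
  have h3 : ‖g n (T y - μ • y)‖ ≤ ε / 2 := by
    refine (hgT n y).trans ?_
    rw [div_lt_iff₀ (by positivity)] at hm
    rw [one_div, ← div_eq_inv_mul, div_le_iff₀ (by positivity)]
    have : (m : ℝ) ≤ n := by exact_mod_cast hn
    nlinarith
  rw [h1]
  exact (norm_add_le _ _).trans_lt (by linarith)

/-- The countable summation property of von Neumann algebras: sequences of positive elements
with bounded partial sums admit sums over all sets of indices, in an additive way. -/
def HasPositiveSums (A : Type*) [NormedRing A] [StarRing A] : Prop :=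
  ∀ y : ℕ → A, (∀ n, ‖∑ j ∈ Finset.range n, star (y j) * y j‖ ≤ 1) →
    ∃ Δ : Set ℕ → A, (∀ j, Δ {j} = star (y j) * y j) ∧
      (∀ E F, Disjoint E F → Δ (E ∪ F) = Δ E + Δ F) ∧
      ∀ E, ‖Δ E‖ ≤ 1 ∧ ∃ z, Δ E = star z * z

theorem not_topologicallyTransitive_of_hasPositiveSums {A : Type*} [CStarAlgebra A]
    (hA : HasPositiveSums A) {X : Type*} [NormedAddCommGroup X] [NormedSpace ℂ X] [CompleteSpace X]
    (hX : ¬ Function.Surjective (inclusionInDoubleDual ℂ X)) (q : A →L[ℂ] X)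
    (hq : Function.Surjective q) (T : X →L[ℂ] X) : ¬ TopologicallyTransitive T := by
  intro hT
  let _ := CStarAlgebra.spectralOrder A
  have := CStarAlgebra.spectralOrderedRing A
  obtain ⟨C, hC0, hC⟩ := q.exists_preimage_norm_le hq
  let R : Submodule ℂ (StrongDual ℂ (StrongDual ℂ X)) :=
    LinearMap.range (inclusionInDoubleDual ℂ X).toLinearMap
  have hR : IsClosed (R : Set (StrongDual ℂ (StrongDual ℂ X))) :=
    (inclusionInDoubleDualLi ℂ (E := X)).isometry.isUniformInducing.isComplete_range.isClosed
  have hRT : ∀ φ ∈ R, (T.precomp ℂ).precomp ℂ φ ∈ R := by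
    rintro _ ⟨x, rfl⟩
    exact ⟨T x, rfl⟩
  obtain ⟨μ, hμ⟩ := exists_approximate_annihilator (Y := StrongDual ℂ (StrongDual ℂ X)) R hR
    (fun h => hX (LinearMap.range_eq_top.1 h)) ((T.precomp ℂ).precomp ℂ) hRT
  have hmass := retainsMass_of_bidual q hC0
    (fun x hx => by
      obtain ⟨a, rfl, ha⟩ := hC x
      exact ⟨a, rfl, ha.trans (by nlinarith)⟩)
    ((T - μ • .id ℂ X).precomp ℂ) (fun ε hε => by
      obtain ⟨ψ, φ, h1, h2, h3, h4, h5⟩ := hμ ε hε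
      refine ⟨ψ.toLinearMap, φ, h1, fun f => by simpa using φ.le_of_opNorm_le h2 f, h3,
        fun x => h4 _ ⟨x, rfl⟩, fun α => ?_⟩
      have h6 : α.comp ((T - μ • .id ℂ X).precomp ℂ) =
          (T.precomp ℂ).precomp ℂ α - μ • α := by
        ext f
        have h7 : f.comp (T - μ • .id ℂ X) = f.comp T - μ • f := by
          ext x
          simp
        change α (f.comp (T - μ • .id ℂ X)) = α (f.comp T) - μ • α f
        rw [h7, map_sub, map_smul]
      rw [h6]
      exact h5 α)
  have hanti : Antitone (fun n : ℕ => {F : A →L[ℂ] ℂ | ∃ g : StrongDual ℂ X, ‖g‖ ≤ 1 ∧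
      ‖(T - μ • .id ℂ X).precomp ℂ g‖ ≤ 1 / ((n : ℝ) + 1) ∧ F = g.comp q}) := by
    rintro m n hmn _ ⟨g, h1, h2, rfl⟩
    exact ⟨g, h1, h2.trans (one_div_le_one_div_of_le (by positivity)
      (by have : (m : ℝ) ≤ n := by exact_mod_cast hmn
          linarith)), rfl⟩
  have hbd : ∀ g : StrongDual ℂ X, ‖g‖ ≤ 1 → ‖g.comp q‖ ≤ ‖q‖ := fun g hg =>
    (g.opNorm_comp_le q).trans (mul_le_of_le_one_left (norm_nonneg _) hg)
  obtain ⟨D, F, hD, hF, hFD, hsum⟩ := hmass.exists_sequence hanti (M := ‖q‖)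
    (by
      rintro n _ ⟨g, h1, -, rfl⟩
      exact hbd g h1) (by positivity)
  choose g hg1 hg2 hg3 using hF
  obtain ⟨Δ, hΔ1, hΔ2, hΔ3⟩ := hA (fun n => CFC.sqrt (D n)) (fun n => by
    have h1 : ∀ j, star (CFC.sqrt (D j)) * CFC.sqrt (D j) = D j := fun j => by
      rw [(CFC.sqrt_nonneg (D j)).isSelfAdjoint.star_eq, CFC.sqrt_mul_sqrt_self (D j) (hD j)]
    simp only [h1]
    exact (CStarAlgebra.norm_le_one_iff_of_nonneg _
      (Finset.sum_nonneg fun j _ => hD j)).2 (hsum n))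
  have hΔ0 : ∀ E, 0 ≤ Δ E := fun E => by
    obtain ⟨z, hz⟩ := (hΔ3 E).2
    rw [hz]
    exact star_mul_self_nonneg z
  have hΔD : ∀ j, Δ {j} = D j := fun j => by
    rw [hΔ1, (CFC.sqrt_nonneg (D j)).isSelfAdjoint.star_eq, CFC.sqrt_mul_sqrt_self (D j) (hD j)]
  obtain ⟨E, hE⟩ := exists_not_tendsto_zero (f := F) (M := ‖q‖)
    (fun n => by
      rw [hg3 n]
      exact hbd _ (hg1 n)) hΔ0
    (fun E => (CStarAlgebra.norm_le_one_iff_of_nonneg _ (hΔ0 E)).1 (hΔ3 E).1) hΔ2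
    (δ := 1 / (64 * C) / 2) (by positivity) (fun n => by rw [hΔD]; exact hFD n)
  refine hE ?_
  simp only [hg3]
  refine hT.tendsto_zero μ hg1 (fun n y => ?_) (q (Δ E))
  simpa using ContinuousLinearMap.le_of_opNorm_le _ (hg2 n) y

end Transitive

section VonNeumann

variable {H : Type*} [NormedAddCommGroup H] [InnerProductSpace ℂ H] [CompleteSpace H]

open scoped InnerProductSpace ENNReal

/-- A square-summable family of operators `w j` has a weakly convergent sum `∑ (w j)⋆ (w j)`. -/
theorem exists_hasSum_inner_of_sum_norm_sq_le (w : ℕ → H →L[ℂ] H)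
    (hw : ∀ (s : Finset ℕ) (x : H), ∑ j ∈ s, ‖w j x‖ ^ 2 ≤ ‖x‖ ^ 2) :
    ∃ D : H →L[ℂ] H, 0 ≤ D ∧ ‖D‖ ≤ 1 ∧
      ∀ x z : H, HasSum (fun j => ⟪w j x, w j z⟫_ℂ) ⟪D x, z⟫_ℂ := by
  have hmem : ∀ x : H, Memℓp (fun j => w j x) 2 := fun x =>
    memℓp_gen' (C := ‖x‖ ^ 2) fun s => by simpa using hw s x
  let L : H →ₗ[ℂ] lp (fun _ : ℕ => H) 2 :=
    { toFun := fun x => ⟨fun j => w j x, hmem x⟩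
      map_add' := fun x z => by ext j; exact map_add (w j) x z
      map_smul' := fun c x => by ext j; simp }
  have hL : ∀ x, ‖L x‖ ≤ 1 * ‖x‖ := fun x => by
    rw [one_mul]
    refine lp.norm_le_of_forall_sum_le (by simp) (norm_nonneg x) fun s => ?_
    simpa [L] using hw s x
  let Y : H →L[ℂ] lp (fun _ : ℕ => H) 2 := L.mkContinuous 1 hL
  have hY : ‖Y‖ ≤ 1 := L.mkContinuous_norm_le zero_le_one hL
  refine ⟨ContinuousLinearMap.adjoint Y ∘L Y, ?_, ?_, fun x z => ?_⟩
  · rw [ContinuousLinearMap.nonneg_iff_isPositive]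
    exact ContinuousLinearMap.isPositive_adjoint_comp_self Y
  · rw [ContinuousLinearMap.norm_adjoint_comp_self]
    exact mul_le_one₀ hY (norm_nonneg _) hY
  · rw [ContinuousLinearMap.comp_apply, ContinuousLinearMap.adjoint_inner_left]
    exact lp.hasSum_inner (Y x) (Y z)

theorem sum_norm_sq_le_of_norm_sum_star_mul_self_le (y : ℕ → H →L[ℂ] H)
    (hy : ∀ n, ‖∑ j ∈ Finset.range n, star (y j) * y j‖ ≤ 1) (s : Finset ℕ) (x : H) :
    ∑ j ∈ s, ‖y j x‖ ^ 2 ≤ ‖x‖ ^ 2 := by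
  obtain ⟨n, hn⟩ := s.exists_nat_subset_range
  refine (Finset.sum_le_sum_of_subset_of_nonneg hn fun _ _ _ => sq_nonneg _).trans ?_
  have h : ⟪(∑ j ∈ Finset.range n, star (y j) * y j) x, x⟫_ℂ
      = ((∑ j ∈ Finset.range n, ‖y j x‖ ^ 2 : ℝ) : ℂ) := by
    rw [sum_apply, sum_inner, Complex.ofReal_sum]
    refine Finset.sum_congr rfl fun j _ => ?_
    rw [mul_apply_eq_comp, ContinuousLinearMap.star_eq_adjoint,
      ContinuousLinearMap.adjoint_inner_left, inner_self_eq_norm_sq_to_K]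
    norm_cast
  have h2 : ‖⟪(∑ j ∈ Finset.range n, star (y j) * y j) x, x⟫_ℂ‖ ≤ ‖x‖ ^ 2 := by
    refine (norm_inner_le_norm _ _).trans ?_
    rw [sq]
    gcongr
    simpa using ContinuousLinearMap.le_of_opNorm_le _ (hy n) x
  rw [h, Complex.norm_real, Real.norm_eq_abs] at h2
  exact (le_abs_self _).trans h2

theorem isClosed_coe_toStarSubalgebra (A : VonNeumannAlgebra H) :
    IsClosed (A.toStarSubalgebra : Set (H →L[ℂ] H)) := by
  rw [VonNeumannAlgebra.coe_toStarSubalgebra, ← A.centralizer_centralizer]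
  exact Set.isClosed_centralizer _

theorem mem_toStarSubalgebra_of_forall_commute (A : VonNeumannAlgebra H) {D : H →L[ℂ] H}
    (h : ∀ u ∈ Set.centralizer (A : Set (H →L[ℂ] H)), Commute D u) : D ∈ A.toStarSubalgebra := by
  rw [VonNeumannAlgebra.mem_carrier, ← A.centralizer_centralizer]
  exact fun u hu => (h u hu).symm

theorem commute_of_hasSum_inner (A : VonNeumannAlgebra H) {w : ℕ → H →L[ℂ] H}
    (hwA : ∀ j, w j ∈ A.toStarSubalgebra) {D : H →L[ℂ] H}
    (hD : ∀ x z : H, HasSum (fun j => ⟪w j x, w j z⟫_ℂ) ⟪D x, z⟫_ℂ) {u : H →L[ℂ] H}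
    (hu : u ∈ Set.centralizer (A : Set (H →L[ℂ] H))) : Commute D u := by
  have hc : ∀ j x, w j (u x) = u (w j x) := fun j x => DFunLike.congr_fun (hu _ (hwA j)) x
  have hu' : star u ∈ Set.centralizer (A : Set (H →L[ℂ] H)) :=
    Set.star_mem_centralizer' (fun _ ha => A.toStarSubalgebra.star_mem' ha) hu
  have hc' : ∀ j x, w j (star u x) = star u (w j x) :=
    fun j x => DFunLike.congr_fun (hu' _ (hwA j)) x
  ext x
  refine ext_inner_right ℂ fun z => ?_
  have h1 := hD (u x) z
  have h2 := hD x (star u z)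
  simp only [hc] at h1
  simp only [hc'] at h2
  simp only [ContinuousLinearMap.star_eq_adjoint,
    ContinuousLinearMap.adjoint_inner_right] at h2
  exact h1.unique h2

theorem hasPositiveSums_toStarSubalgebra (A : VonNeumannAlgebra H) :
    HasPositiveSums A.toStarSubalgebra := by
  classical
  intro y hy
  have hs : ∀ (s : Finset ℕ) (x : H), ∑ j ∈ s, ‖(y j : H →L[ℂ] H) x‖ ^ 2 ≤ ‖x‖ ^ 2 :=
    sum_norm_sq_le_of_norm_sum_star_mul_self_le (fun j => (y j : H →L[ℂ] H)) fun n => by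
      simpa using hy n
  let w : Set ℕ → ℕ → H →L[ℂ] H := fun E j => if j ∈ E then (y j : H →L[ℂ] H) else 0
  have hwA : ∀ E j, w E j ∈ A.toStarSubalgebra := fun E j => by
    by_cases h : j ∈ E
    · simp only [w, if_pos h]; exact (y j).2
    · simp only [w, if_neg h]; exact zero_mem _
  have hws : ∀ E (s : Finset ℕ) (x : H), ∑ j ∈ s, ‖w E j x‖ ^ 2 ≤ ‖x‖ ^ 2 := fun E s x => by
    refine (Finset.sum_le_sum fun j _ => ?_).trans (hs s x)
    by_cases h : j ∈ E <;> simp [w, h]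
  choose D hD0 hD1 hD using fun E => exists_hasSum_inner_of_sum_norm_sq_le (w E) (hws E)
  have hDA : ∀ E, D E ∈ A.toStarSubalgebra := fun E =>
    mem_toStarSubalgebra_of_forall_commute A fun u hu =>
      commute_of_hasSum_inner A (hwA E) (hD E) hu
  refine ⟨fun E => ⟨D E, hDA E⟩, fun j => ?_, fun E F hEF => ?_, fun E => ⟨hD1 E, ?_⟩⟩
  · refine Subtype.ext (ContinuousLinearMap.ext fun x => ext_inner_right ℂ fun z => ?_)
    have h1 := hD {j} x z
    have h2 : HasSum (fun i => ⟪w {j} i x, w {j} i z⟫_ℂ) ⟪w {j} j x, w {j} j z⟫_ℂ :=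
      hasSum_single j fun i hi => by simp [w, hi]
    rw [h1.unique h2]
    simp [w, ContinuousLinearMap.star_eq_adjoint, ContinuousLinearMap.adjoint_inner_left]
  · refine Subtype.ext (ContinuousLinearMap.ext fun x => ext_inner_right ℂ fun z => ?_)
    have h2 := (hD E x z).add (hD F x z)
    rw [← inner_add_left] at h2
    refine (hD (E ∪ F) x z).unique (h2.congr_fun fun j => ?_)
    have hj : j ∈ E → j ∉ F := fun h h' => Set.disjoint_left.mp hEF h h'
    by_cases h : j ∈ E <;> by_cases h' : j ∈ F <;> simp_all [w]
  · have hc : ∀ u ∈ Set.centralizer (A : Set (H →L[ℂ] H)), Commute (CFC.sqrt (D E)) u :=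
      fun u hu => (commute_of_hasSum_inner A (hwA E) (hD E) hu).cfcₙ_nnreal _
    refine ⟨⟨CFC.sqrt (D E), mem_toStarSubalgebra_of_forall_commute A hc⟩, Subtype.ext ?_⟩
    change D E = star (CFC.sqrt (D E)) * CFC.sqrt (D E)
    rw [(CFC.sqrt_nonneg (D E)).isSelfAdjoint.star_eq, CFC.sqrt_mul_sqrt_self _ (hD0 E)]

end VonNeumann

/-- Let `X` be a non-reflexive complex Banach space which is a quotient of a von Neumann
algebra (i.e. `X ≃ A/Z` as Banach spaces, for a von Neumann algebra `A` and a closed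
subspace `Z` of `A`).  Then no bounded linear operator on `X` is topologically transitive. -/
theorem not_topologicallyTransitive_of_quotient_vonNeumann
    (X : Type*) [NormedAddCommGroup X] [NormedSpace ℂ X] [CompleteSpace X]
    (hnonrefl : ¬ Function.Surjective (inclusionInDoubleDual ℂ X))
    (H : Type*) [NormedAddCommGroup H] [InnerProductSpace ℂ H] [CompleteSpace H]
    (A : VonNeumannAlgebra H)
    (Z : Submodule ℂ A.toStarSubalgebra.toSubalgebra)
    (hZ : IsClosed (Z : Set A.toStarSubalgebra.toSubalgebra))
    (e : X ≃L[ℂ] (A.toStarSubalgebra.toSubalgebra ⧸ Z))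
    (T : X →L[ℂ] X) :
    ¬ TopologicallyTransitive T := by
  have : IsClosed (A.toStarSubalgebra : Set (H →L[ℂ] H)) := isClosed_coe_toStarSubalgebra A
  let i : A.toStarSubalgebra →L[ℂ] A.toStarSubalgebra.toSubalgebra :=
    { toFun := fun a => ⟨a.1, a.2⟩
      map_add' := fun _ _ => rfl
      map_smul' := fun _ _ => rfl
      cont := continuous_subtype_val.subtype_mk _ }
  have hi : Function.Surjective i := fun a => ⟨⟨a.1, a.2⟩, rfl⟩
  exact not_topologicallyTransitive_of_hasPositiveSums (hasPositiveSums_toStarSubalgebra A) hnonrefl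
    ((e.symm : (A.toStarSubalgebra.toSubalgebra ⧸ Z) →L[ℂ] X) ∘L Z.mkQL ∘L i)
    (e.symm.surjective.comp (Z.mkQ_surjective.comp hi)) T
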